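/- For every p ∈ (0,1) there exists n_0(p) ∈ ℕ such that for all m, n ≥ n_0(p), e^{2H[B(m+n,p)]} ≥ e^{2H[B(m,p)]} + e^{2H[B(n,p)]}. -/

import Mathlib

open Real

noncomputable def binEnt (p : ℝ) : ℝ := -(p * Real.log p) - (1 - p) * Real.log (1 - p)

noncomputable def binomPmf (n : ℕ) (p : ℝ) (k : ℕ) : ℝ :=
  (n.choose k : ℝ) * p ^ k * (1 - p) ^ (n - k)

noncomputable def binomEnt (n : ℕ) (p : ℝ) : ℝ :=
  -∑ k ∈ Finset.range (n + 1), binomPmf n p k * Real.log (binomPmf n p k)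

/-- Expectation under the binomial distribution. -/
noncomputable def bE (n : ℕ) (p : ℝ) (f : ℕ → ℝ) : ℝ :=
  ∑ k ∈ Finset.range (n + 1), binomPmf n p k * f k

lemma bE_add (n : ℕ) (p : ℝ) (f g : ℕ → ℝ) :
    bE n p (fun k => f k + g k) = bE n p f + bE n p g := by
  simp [bE, mul_add, Finset.sum_add_distrib]

lemma bE_mul (n : ℕ) (p c : ℝ) (f : ℕ → ℝ) :
    bE n p (fun k => c * f k) = c * bE n p f := by
  simp only [bE, Finset.mul_sum]
  exact Finset.sum_congr rfl fun k _ => by ring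

lemma bE_congr (n : ℕ) (p : ℝ) (f g : ℕ → ℝ) (h : ∀ k, k ≤ n → f k = g k) :
    bE n p f = bE n p g := by
  refine Finset.sum_congr rfl fun k hk => ?_
  rw [h k (by simpa [Nat.lt_succ_iff] using hk)]

lemma binomPmf_pos (n : ℕ) (p : ℝ) (hp : 0 < p) (hq : 0 < 1 - p) (k : ℕ) (hk : k ≤ n) :
    0 < binomPmf n p k := by
  have := Nat.choose_pos hk
  unfold binomPmf
  positivity

lemma bE_mono (n : ℕ) (p : ℝ) (hp : 0 < p) (hq : 0 < 1 - p) (f g : ℕ → ℝ)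
    (h : ∀ k, k ≤ n → f k ≤ g k) : bE n p f ≤ bE n p g := by
  refine Finset.sum_le_sum fun k hk => ?_
  have hk : k ≤ n := by simpa [Nat.lt_succ_iff] using hk
  exact mul_le_mul_of_nonneg_left (h k hk) (binomPmf_pos n p hp hq k hk).le

lemma pmf_succ_mul (n : ℕ) (p : ℝ) (k : ℕ) :
    binomPmf (n + 1) p (k + 1) * ((k : ℝ) + 1) = (n + 1) * p * binomPmf n p k := by
  have h := Nat.add_one_mul_choose_eq n k
  have h' : ((n : ℝ) + 1) * (n.choose k) = ((n + 1).choose (k + 1)) * (k + 1) := by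
    exact_mod_cast h
  unfold binomPmf
  rw [show n + 1 - (k + 1) = n - k by omega, pow_succ]
  linear_combination (-(p ^ k * p * (1 - p) ^ (n - k))) * h'

lemma pmf_mul_sub (n : ℕ) (p : ℝ) (k : ℕ) (hk : k ≤ n) :
    binomPmf (n + 1) p k * ((n : ℝ) + 1 - k) = (n + 1) * (1 - p) * binomPmf n p k := by
  have h := Nat.choose_mul_succ_eq n k
  have h' : ((n.choose k : ℕ) : ℝ) * (n + 1) = ((n + 1).choose k) * ((n : ℝ) + 1 - k) := by
    have : ((n + 1 - k : ℕ) : ℝ) = (n : ℝ) + 1 - k := by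
      rw [Nat.cast_sub (by omega)]; push_cast; ring
    rw [← this]; exact_mod_cast h
  unfold binomPmf
  rw [show n + 1 - k = (n - k) + 1 by omega, pow_succ]
  linear_combination (-(p ^ k * (1 - p) * (1 - p) ^ (n - k))) * h'

lemma bE_K (n : ℕ) (p : ℝ) (g : ℕ → ℝ) :
    bE (n + 1) p (fun k => (k : ℝ) * g k) = (n + 1) * p * bE n p (fun k => g (k + 1)) := by
  unfold bE
  rw [Finset.sum_range_succ', Finset.mul_sum]
  simp only [Nat.cast_zero, zero_mul, mul_zero, add_zero]
  refine Finset.sum_congr rfl fun k _ => ?_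
  have := pmf_succ_mul n p k
  push_cast
  linear_combination (g (k + 1)) * this

lemma bE_NK (n : ℕ) (p : ℝ) (g : ℕ → ℝ) :
    bE (n + 1) p (fun k => ((n : ℝ) + 1 - k) * g k) = (n + 1) * (1 - p) * bE n p g := by
  unfold bE
  rw [Finset.sum_range_succ, Finset.mul_sum]
  simp only [Nat.cast_add, Nat.cast_one, sub_self, zero_mul, mul_zero, add_zero]
  refine Finset.sum_congr rfl fun k hk => ?_
  have := pmf_mul_sub n p k (by simpa [Nat.lt_succ_iff] using hk)
  linear_combination (g k) * this

lemma bE_succ (n : ℕ) (p : ℝ) (f : ℕ → ℝ) :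
    bE (n + 1) p f = bE n p (fun k => (1 - p) * f k + p * f (k + 1)) := by
  have h1 := bE_K n p f
  have h2 := bE_NK n p f
  have h3 : bE (n + 1) p (fun k => ((n : ℝ) + 1) * f k)
      = bE (n + 1) p (fun k => (k : ℝ) * f k) + bE (n + 1) p (fun k => ((n : ℝ) + 1 - k) * f k) := by
    rw [← bE_add]; exact bE_congr _ _ _ _ fun k _ => by ring
  rw [bE_mul, h1, h2] at h3
  rw [bE_add, bE_mul, bE_mul]
  have : (n : ℝ) + 1 ≠ 0 := by positivity
  apply mul_left_cancel₀ this
  linear_combination h3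

/-- Entropy increment as an expected divergence. -/
lemma ent_diff (n : ℕ) (p : ℝ) (hp : 0 < p) (hq : 0 < 1 - p) :
    ((n : ℝ) + 1) * (binomEnt (n + 1) p - binomEnt n p) =
      bE (n + 1) p (fun k => (k : ℝ) * Real.log (k / ((n + 1) * p))
        + ((n : ℝ) + 1 - k) * Real.log (((n : ℝ) + 1 - k) / ((n + 1) * (1 - p)))) := by
  have e1 : binomEnt (n + 1) p = (-1) * bE (n + 1) p (fun k => Real.log (binomPmf (n + 1) p k)) := by
    simp [binomEnt, bE]
  have e2 : binomEnt n p = (-1) * bE n p (fun k => Real.log (binomPmf n p k)) := by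
    simp [binomEnt, bE]
  rw [bE_add, bE_K n p (fun k => Real.log ((k : ℝ) / ((n + 1) * p))),
    bE_NK n p (fun k => Real.log (((n : ℝ) + 1 - k) / ((n + 1) * (1 - p)))),
    e1, e2, bE_succ,
    show ∀ a b : ℝ, (-1) * a - (-1) * b = (-1) * a + 1 * b from fun a b => by ring]
  simp only [← bE_mul, ← bE_add]
  refine bE_congr _ _ _ _ fun k hk => ?_
  have b0 := binomPmf_pos n p hp hq k hk
  have hkn : (0 : ℝ) < (n : ℝ) + 1 - k := by
    have : (k : ℝ) ≤ n := by exact_mod_cast hk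
    linarith
  have hN : (0 : ℝ) < (n : ℝ) + 1 := by positivity
  have hk1 : (0 : ℝ) < (k : ℝ) + 1 := by positivity
  have a1 : binomPmf (n + 1) p (k + 1) = binomPmf n p k / (((k + 1 : ℕ) : ℝ) / ((n + 1) * p)) := by
    have := pmf_succ_mul n p k
    push_cast
    field_simp
    linear_combination this
  have a2 : binomPmf (n + 1) p k = binomPmf n p k / (((n : ℝ) + 1 - k) / ((n + 1) * (1 - p))) := by
    have := pmf_mul_sub n p k hk
    field_simp
    linear_combination this
  rw [a1, a2, Real.log_div b0.ne' (by positivity), Real.log_div b0.ne' (by positivity)]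
  ring

/-- Central moments. -/
lemma moments (p : ℝ) (n : ℕ) :
    bE n p (fun k => ((k : ℝ) - n * p) ^ 0) = 1 ∧
    bE n p (fun k => ((k : ℝ) - n * p) ^ 1) = 0 ∧
    bE n p (fun k => ((k : ℝ) - n * p) ^ 2) = n * p * (1 - p) ∧
    bE n p (fun k => ((k : ℝ) - n * p) ^ 3) = n * p * (1 - p) * (1 - 2 * p) ∧
    bE n p (fun k => ((k : ℝ) - n * p) ^ 4) =
      n * p * (1 - p) * (1 + (3 * n - 6) * (p * (1 - p))) ∧
    bE n p (fun k => ((k : ℝ) - n * p) ^ 5) =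
      n * p * (1 - p) * (1 - 2 * p) * (1 + (10 * n - 12) * (p * (1 - p))) ∧
    bE n p (fun k => ((k : ℝ) - n * p) ^ 6) =
      n * p * (1 - p) * (1 - 30 * (p * (1 - p)) * (1 - 4 * (p * (1 - p)))
        + 5 * n * (p * (1 - p)) * (5 - 26 * (p * (1 - p))) + 15 * n ^ 2 * (p * (1 - p)) ^ 2) := by
  induction n with
  | zero => simp [bE, binomPmf]
  | succ n ih =>
    obtain ⟨h0, h1, h2, h3, h4, h5, h6⟩ := ih
    have key : ∀ j : ℕ, bE (n + 1) p (fun k => ((k : ℝ) - ((n + 1 : ℕ) : ℝ) * p) ^ j) =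
        ∑ i ∈ Finset.range (j + 1), ((1 - p) * (-p) ^ (j - i) + p * (1 - p) ^ (j - i)) * (j.choose i)
          * bE n p (fun k => ((k : ℝ) - n * p) ^ i) := by
      intro j
      rw [bE_succ]
      simp only [bE, Finset.mul_sum]
      rw [Finset.sum_comm]
      refine Finset.sum_congr rfl fun k _ => ?_
      rw [show (k : ℝ) - ((n + 1 : ℕ) : ℝ) * p = (k - n * p) + (-p) by push_cast; ring,
        show ((k + 1 : ℕ) : ℝ) - ((n + 1 : ℕ) : ℝ) * p = (k - n * p) + (1 - p) by push_cast; ring,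
        add_pow, add_pow, Finset.mul_sum, Finset.mul_sum, ← Finset.sum_add_distrib, Finset.mul_sum]
      refine Finset.sum_congr rfl fun i _ => ?_
      ring
    simp only [key]
    have c62 : Nat.choose 6 2 = 15 := rfl
    have c63 : Nat.choose 6 3 = 20 := rfl
    have c64 : Nat.choose 6 4 = 15 := rfl
    have c52 : Nat.choose 5 2 = 10 := rfl
    have c53 : Nat.choose 5 3 = 10 := rfl
    have c42 : Nat.choose 4 2 = 6 := rfl
    have c32 : Nat.choose 3 2 = 3 := rfl
    have c43 : Nat.choose 4 3 = 4 := rfl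
    have c54 : Nat.choose 5 4 = 5 := rfl
    have c65 : Nat.choose 6 5 = 6 := rfl
    refine ⟨?_, ?_, ?_, ?_, ?_, ?_, ?_⟩ <;>
    · simp only [Finset.sum_range_succ, Finset.sum_range_zero, h0, h1, h2, h3, h4, h5, h6,
        c62, c63, c64, c52, c53, c42, c32, c43, c54, c65, Nat.choose_zero_right, Nat.choose_one_right, Nat.choose_self]
      push_cast
      ring

lemma conv_nonneg (F F' F'' : ℝ → ℝ) (h1 : ∀ x, -1 < x → HasDerivAt F (F' x) x)
    (h2 : ∀ x, -1 < x → HasDerivAt F' (F'' x) x) (h3 : ∀ x, -1 < x → 0 ≤ F'' x)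
    (h4 : F 0 = 0) (h5 : F' 0 = 0) (x : ℝ) (hx : -1 < x) : 0 ≤ F x := by
  have m : MonotoneOn F' (Set.Ioi (-1)) := by
    apply monotoneOn_of_deriv_nonneg (convex_Ioi _)
    · exact fun y hy => (h2 y hy).continuousAt.continuousWithinAt
    · intro y hy
      rw [interior_Ioi] at hy
      exact (h2 y hy).differentiableAt.differentiableWithinAt
    · intro y hy
      rw [interior_Ioi] at hy
      rw [(h2 y hy).deriv]; exact h3 y hy
  rcases le_total 0 x with h | h
  · have : MonotoneOn F (Set.Ici 0) := by
      apply monotoneOn_of_deriv_nonneg (convex_Ici _)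
      · intro y hy
        have : (0 : ℝ) ≤ y := hy
        exact (h1 y (by linarith)).continuousAt.continuousWithinAt
      · intro y hy
        rw [interior_Ici] at hy
        have : (0 : ℝ) < y := hy
        exact (h1 y (by linarith)).differentiableAt.differentiableWithinAt
      · intro y hy
        rw [interior_Ici] at hy
        have hy : (0 : ℝ) < y := hy
        rw [(h1 y (by linarith)).deriv, ← h5]
        exact m (by simp) (by simp; linarith) hy.le
    rw [← h4]; exact this (by simp) h h
  · have : AntitoneOn F (Set.Ioc (-1) 0) := by
      apply antitoneOn_of_deriv_nonpos (convex_Ioc _ _)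
      · exact fun y hy => (h1 y hy.1).continuousAt.continuousWithinAt
      · intro y hy
        rw [interior_Ioc] at hy
        exact (h1 y hy.1).differentiableAt.differentiableWithinAt
      · intro y hy
        rw [interior_Ioc] at hy
        rw [(h1 y hy.1).deriv, ← h5]
        exact m hy.1 (by simp) hy.2.le
    rw [← h4]; exact this ⟨hx, h⟩ (by simp) h

lemma hasDerivAt_log1 (x : ℝ) (hx : -1 < x) :
    HasDerivAt (fun x => Real.log (1 + x)) (1 / (1 + x)) x := by
  have : HasDerivAt (fun x : ℝ => 1 + x) 1 x := (hasDerivAt_id x).const_add 1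
  exact this.log (by linarith)

lemma hasDerivAt_xlog (x : ℝ) (hx : -1 < x) :
    HasDerivAt (fun x => (1 + x) * Real.log (1 + x)) (Real.log (1 + x) + 1) x := by
  have h : HasDerivAt (fun x : ℝ => 1 + x) 1 x := (hasDerivAt_id x).const_add 1
  have := h.mul (hasDerivAt_log1 x hx)
  refine this.congr_deriv ?_
  have h0 : 1 + x ≠ 0 := by linarith
  rw [one_mul, mul_one_div_cancel h0]

lemma hasDerivAt_mon (c : ℝ) (n : ℕ) (x : ℝ) :
    HasDerivAt (fun x : ℝ => c * x ^ n) (c * (n * x ^ (n - 1))) x :=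
  (hasDerivAt_pow n x).const_mul c

lemma xlog5 (x : ℝ) (hx : -1 ≤ x) :
    x + x ^ 2 / 2 - x ^ 3 / 6 + x ^ 4 / 12 - x ^ 5 / 20 ≤ (1 + x) * Real.log (1 + x) := by
  rcases hx.eq_or_lt with rfl | hx
  · norm_num
  have := conv_nonneg (fun x => (1 + x) * Real.log (1 + x) -
      (1 * x ^ 1 + 1 / 2 * x ^ 2 + (-1 / 6) * x ^ 3 + 1 / 12 * x ^ 4 + (-1 / 20) * x ^ 5))
    (fun x => Real.log (1 + x) + 1 -
      (1 + 1 * x ^ 1 + (-1 / 2) * x ^ 2 + 1 / 3 * x ^ 3 + (-1 / 4) * x ^ 4))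
    (fun x => 1 / (1 + x) - (1 - x + x ^ 2 - x ^ 3)) ?_ ?_ ?_ (by simp) (by simp) x hx
  · linarith
  · intro x hx
    have := (hasDerivAt_xlog x hx).sub (((((hasDerivAt_mon 1 1 x).add (hasDerivAt_mon (1 / 2) 2 x)).add
      (hasDerivAt_mon (-1 / 6) 3 x)).add (hasDerivAt_mon (1 / 12) 4 x)).add (hasDerivAt_mon (-1 / 20) 5 x))
    refine this.congr_deriv ?_
    norm_num; ring
  · intro x hx
    have := ((hasDerivAt_log1 x hx).add_const 1).sub (((((hasDerivAt_mon 1 1 x).const_add 1).add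
      (hasDerivAt_mon (-1 / 2) 2 x)).add (hasDerivAt_mon (1 / 3) 3 x)).add (hasDerivAt_mon (-1 / 4) 4 x))
    refine this.congr_deriv ?_
    norm_num; ring
  · intro x hx
    have h : 0 < 1 + x := by linarith
    have : 1 / (1 + x) - (1 - x + x ^ 2 - x ^ 3) = x ^ 4 / (1 + x) := by field_simp; ring
    rw [this]; positivity

lemma xlog7 (x : ℝ) (hx : -1 ≤ x) :
    x + x ^ 2 / 2 - x ^ 3 / 6 + x ^ 4 / 12 - x ^ 5 / 20 + x ^ 6 / 30 - x ^ 7 / 42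
      ≤ (1 + x) * Real.log (1 + x) := by
  rcases hx.eq_or_lt with rfl | hx
  · norm_num
  have := conv_nonneg (fun x => (1 + x) * Real.log (1 + x) -
      (1 * x ^ 1 + 1 / 2 * x ^ 2 + (-1 / 6) * x ^ 3 + 1 / 12 * x ^ 4 + (-1 / 20) * x ^ 5
        + 1 / 30 * x ^ 6 + (-1 / 42) * x ^ 7))
    (fun x => Real.log (1 + x) + 1 -
      (1 + 1 * x ^ 1 + (-1 / 2) * x ^ 2 + 1 / 3 * x ^ 3 + (-1 / 4) * x ^ 4
        + 1 / 5 * x ^ 5 + (-1 / 6) * x ^ 6))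
    (fun x => 1 / (1 + x) - (1 - x + x ^ 2 - x ^ 3 + x ^ 4 - x ^ 5)) ?_ ?_ ?_ (by simp) (by simp) x hx
  · linarith
  · intro x hx
    have := (hasDerivAt_xlog x hx).sub (((((((hasDerivAt_mon 1 1 x).add (hasDerivAt_mon (1 / 2) 2 x)).add
      (hasDerivAt_mon (-1 / 6) 3 x)).add (hasDerivAt_mon (1 / 12) 4 x)).add
      (hasDerivAt_mon (-1 / 20) 5 x)).add (hasDerivAt_mon (1 / 30) 6 x)).add (hasDerivAt_mon (-1 / 42) 7 x))
    refine this.congr_deriv ?_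
    norm_num; ring
  · intro x hx
    have := ((hasDerivAt_log1 x hx).add_const 1).sub (((((((hasDerivAt_mon 1 1 x).const_add 1).add
      (hasDerivAt_mon (-1 / 2) 2 x)).add (hasDerivAt_mon (1 / 3) 3 x)).add (hasDerivAt_mon (-1 / 4) 4 x)).add
      (hasDerivAt_mon (1 / 5) 5 x)).add (hasDerivAt_mon (-1 / 6) 6 x))
    refine this.congr_deriv ?_
    norm_num; ring
  · intro x hx
    have h : 0 < 1 + x := by linarith
    have : 1 / (1 + x) - (1 - x + x ^ 2 - x ^ 3 + x ^ 4 - x ^ 5) = x ^ 6 / (1 + x) := by field_simp; ring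
    rw [this]; positivity

lemma log_upper (n : ℕ) (hn : 1 ≤ n) :
    Real.log (((n : ℝ) + 1) / n) ≤ (1 / ((n : ℝ) + 1)) + (1 / ((n : ℝ) + 1)) ^ 2 / 2
      + (1 / ((n : ℝ) + 1)) ^ 3 / 3 + 2 * (1 / ((n : ℝ) + 1)) ^ 4 := by
  have hn' : (1 : ℝ) ≤ n := by exact_mod_cast hn
  set x : ℝ := 1 / ((n : ℝ) + 1) with hx
  have hx0 : 0 < x := by positivity
  have hx2 : x ≤ 1 / 2 := by
    rw [hx]; apply one_div_le_one_div_of_le <;> linarith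
  have e : ((n : ℝ) + 1) / n = (1 - x)⁻¹ := by
    have h0 : (n : ℝ) ≠ 0 := by linarith
    have h1 : 1 - x = n / ((n : ℝ) + 1) := by rw [hx]; field_simp; ring
    rw [h1, inv_div]
  rw [e, Real.log_inv]
  have := Real.abs_log_sub_add_sum_range_le (x := x) (by rw [abs_of_pos hx0]; linarith) 3
  rw [abs_of_pos hx0] at this
  have h1 := (abs_le.1 this).1
  norm_num [Finset.sum_range_succ] at h1
  have h2 : x ^ 4 / (1 - x) ≤ 2 * x ^ 4 := by
    rw [div_le_iff₀ (by linarith)]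
    nlinarith [pow_pos hx0 4]
  linarith

/-- The quintic lower bound on the entropy increment. -/
lemma lower5 (n : ℕ) (p : ℝ) (hp : 0 < p) (hq : 0 < 1 - p) (x : ℝ) (hx : x = 1 / ((n : ℝ) + 1)) :
    x / 2 + x ^ 2 * ((1 - p * (1 - p)) / (12 * (p * (1 - p))))
      + x ^ 3 * ((1 - 3 * (p * (1 - p))) * (1 - 6 * (p * (1 - p))) / (12 * (p * (1 - p)) ^ 2)
        - (1 - 2 * p) ^ 2 * (1 - 2 * (p * (1 - p))) * (10 * (p * (1 - p)))
          / (20 * (p * (1 - p)) ^ 3))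
      - x ^ 4 * ((1 - 2 * p) ^ 2 * (1 - 2 * (p * (1 - p))) * (1 - 12 * (p * (1 - p)))
          / (20 * (p * (1 - p)) ^ 3))
      ≤ binomEnt (n + 1) p - binomEnt n p := by
  have hN : (0 : ℝ) < (n : ℝ) + 1 := by positivity
  have hd := ent_diff n p hp hq
  obtain ⟨h0, h1, h2, h3, h4, h5, h6⟩ := moments p (n + 1)
  have hle : bE (n + 1) p (fun k =>
      (x * (1 / p + 1 / (1 - p)) / 2) * ((k : ℝ) - ((n + 1 : ℕ) : ℝ) * p) ^ 2
      + (-(x ^ 2 * (1 / p ^ 2 - 1 / (1 - p) ^ 2) / 6)) * ((k : ℝ) - ((n + 1 : ℕ) : ℝ) * p) ^ 3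
      + (x ^ 3 * (1 / p ^ 3 + 1 / (1 - p) ^ 3) / 12) * ((k : ℝ) - ((n + 1 : ℕ) : ℝ) * p) ^ 4
      + (-(x ^ 4 * (1 / p ^ 4 - 1 / (1 - p) ^ 4) / 20)) * ((k : ℝ) - ((n + 1 : ℕ) : ℝ) * p) ^ 5)
      ≤ ((n : ℝ) + 1) * (binomEnt (n + 1) p - binomEnt n p) := by
    rw [hd]
    refine bE_mono _ _ hp hq _ _ fun k hk => ?_
    have hk' : (k : ℝ) ≤ n + 1 := by exact_mod_cast hk
    have e1 : (k : ℝ) / ((n + 1) * p) = 1 + ((k : ℝ) - (n + 1) * p) / ((n + 1) * p) := by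
      field_simp; ring
    have e2 : ((n : ℝ) + 1 - k) / ((n + 1) * (1 - p))
        = 1 + (-((k : ℝ) - (n + 1) * p)) / ((n + 1) * (1 - p)) := by
      field_simp; ring
    have p1 : (0 : ℝ) ≤ (k : ℝ) / ((n + 1) * p) := by positivity
    have p2 : (0 : ℝ) ≤ ((n : ℝ) + 1 - k) / ((n + 1) * (1 - p)) :=
      div_nonneg (by linarith) (by positivity)
    have l1 := xlog5 (((k : ℝ) - (n + 1) * p) / ((n + 1) * p)) (by linarith)
    have l2 := xlog5 ((-((k : ℝ) - (n + 1) * p)) / ((n + 1) * (1 - p))) (by linarith)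
    rw [← e1] at l1
    rw [← e2] at l2
    have m1 := mul_le_mul_of_nonneg_left l1 (by positivity : (0 : ℝ) ≤ (n + 1) * p)
    have m2 := mul_le_mul_of_nonneg_left l2 (by positivity : (0 : ℝ) ≤ (n + 1) * (1 - p))
    have f1 : ((n : ℝ) + 1) * p * ((k : ℝ) / ((n + 1) * p) * Real.log ((k : ℝ) / ((n + 1) * p)))
        = k * Real.log ((k : ℝ) / ((n + 1) * p)) := by
      rw [← mul_assoc]; congr 1; field_simp
    have f2 : ((n : ℝ) + 1) * (1 - p) * (((n : ℝ) + 1 - k) / ((n + 1) * (1 - p))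
        * Real.log (((n : ℝ) + 1 - k) / ((n + 1) * (1 - p))))
        = ((n : ℝ) + 1 - k) * Real.log (((n : ℝ) + 1 - k) / ((n + 1) * (1 - p))) := by
      rw [← mul_assoc]; congr 1; field_simp
    rw [f1] at m1
    rw [f2] at m2
    refine le_trans (le_of_eq ?_) (add_le_add m1 m2)
    push_cast
    generalize (k : ℝ) - (n + 1) * p = X
    generalize 1 - p = q at *
    rw [hx]
    field_simp
    ring
  rw [bE_add, bE_add, bE_add, bE_mul, bE_mul, bE_mul, bE_mul, h2, h3, h4, h5] at hle
  have : binomEnt (n + 1) p - binomEnt n p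
      = x * (((n : ℝ) + 1) * (binomEnt (n + 1) p - binomEnt n p)) := by
    rw [hx]; field_simp
  rw [this]
  refine le_trans (le_of_eq ?_) (mul_le_mul_of_nonneg_left hle (by rw [hx]; positivity))
  have hx1 : ((n + 1 : ℕ) : ℝ) = 1 / x := by rw [hx]; push_cast; field_simp
  rw [hx1]
  have hx0 : x ≠ 0 := by rw [hx]; positivity
  have hq' : (1 - p) ≠ 0 := hq.ne'
  field_simp
  ring

lemma lower7 (n : ℕ) (p : ℝ) (hp : p = 1 / 2) (x : ℝ) (hx : x = 1 / ((n : ℝ) + 1)) :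
    x / 2 + x ^ 2 / 4 + x ^ 3 / 3 - x ^ 4 + 8 / 15 * x ^ 5
      ≤ binomEnt (n + 1) p - binomEnt n p := by
  have hN : (0 : ℝ) < (n : ℝ) + 1 := by positivity
  have hd := ent_diff n p (by rw [hp]; norm_num) (by rw [hp]; norm_num)
  obtain ⟨h0, h1, h2, h3, h4, h5, h6⟩ := moments p (n + 1)
  have hle : bE (n + 1) p (fun k =>
      (2 * x) * ((k : ℝ) - ((n + 1 : ℕ) : ℝ) * p) ^ 2
      + (4 / 3 * x ^ 3) * ((k : ℝ) - ((n + 1 : ℕ) : ℝ) * p) ^ 4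
      + (32 / 15 * x ^ 5) * ((k : ℝ) - ((n + 1 : ℕ) : ℝ) * p) ^ 6)
      ≤ ((n : ℝ) + 1) * (binomEnt (n + 1) p - binomEnt n p) := by
    rw [hd]
    refine bE_mono _ _ (by rw [hp]; norm_num) (by rw [hp]; norm_num) _ _ fun k hk => ?_
    have hk' : (k : ℝ) ≤ n + 1 := by exact_mod_cast hk
    rw [show 1 - p = p by rw [hp]; norm_num]
    have hp0 : 0 < p := by rw [hp]; norm_num
    have e1 : (k : ℝ) / ((n + 1) * p) = 1 + ((k : ℝ) - (n + 1) * p) / ((n + 1) * p) := by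
      field_simp; ring
    have e2 : ((n : ℝ) + 1 - k) / ((n + 1) * p)
        = 1 + (-((k : ℝ) - (n + 1) * p)) / ((n + 1) * p) := by
      rw [hp]; field_simp; ring
    have p1 : (0 : ℝ) ≤ (k : ℝ) / ((n + 1) * p) := by positivity
    have p2 : (0 : ℝ) ≤ ((n : ℝ) + 1 - k) / ((n + 1) * p) :=
      div_nonneg (by linarith) (by positivity)
    have l1 := xlog7 (((k : ℝ) - (n + 1) * p) / ((n + 1) * p)) (by linarith)
    have l2 := xlog7 ((-((k : ℝ) - (n + 1) * p)) / ((n + 1) * p)) (by linarith)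
    rw [← e1] at l1
    rw [← e2] at l2
    have m1 := mul_le_mul_of_nonneg_left l1 (by positivity : (0 : ℝ) ≤ (n + 1) * p)
    have m2 := mul_le_mul_of_nonneg_left l2 (by positivity : (0 : ℝ) ≤ (n + 1) * p)
    have f1 : ((n : ℝ) + 1) * p * ((k : ℝ) / ((n + 1) * p) * Real.log ((k : ℝ) / ((n + 1) * p)))
        = k * Real.log ((k : ℝ) / ((n + 1) * p)) := by
      rw [← mul_assoc]; congr 1; field_simp
    have f2 : ((n : ℝ) + 1) * p * (((n : ℝ) + 1 - k) / ((n + 1) * p)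
        * Real.log (((n : ℝ) + 1 - k) / ((n + 1) * p)))
        = ((n : ℝ) + 1 - k) * Real.log (((n : ℝ) + 1 - k) / ((n + 1) * p)) := by
      rw [← mul_assoc]; congr 1; field_simp
    rw [f1] at m1
    rw [f2] at m2
    refine le_trans (le_of_eq ?_) (add_le_add m1 m2)
    push_cast
    generalize (k : ℝ) - (n + 1) * p = X
    rw [hx, hp]
    field_simp
    ring
  rw [bE_add, bE_add, bE_mul, bE_mul, bE_mul, h2, h4, h6] at hle
  have : binomEnt (n + 1) p - binomEnt n p
      = x * (((n : ℝ) + 1) * (binomEnt (n + 1) p - binomEnt n p)) := by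
    rw [hx]; field_simp
  rw [this]
  refine le_trans (le_of_eq ?_) (mul_le_mul_of_nonneg_left hle (by rw [hx]; positivity))
  have hx1 : ((n + 1 : ℕ) : ℝ) = 1 / x := by rw [hx]; push_cast; field_simp
  rw [hx1]
  have hx0 : x ≠ 0 := by rw [hx]; positivity
  rw [hp]
  field_simp
  ring

lemma eventually_poly (a b c : ℝ) (ha : 0 < a) :
    ∀ᶠ n : ℕ in Filter.atTop, 0 ≤ a + b * (1 / ((n : ℝ) + 1)) + c * (1 / ((n : ℝ) + 1)) ^ 2 := by
  have h := tendsto_one_div_add_atTop_nhds_zero_nat (𝕜 := ℝ)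
  have h2 := ((h.const_mul b).const_add a).add ((h.pow 2).const_mul c)
  have h3 := h2.eventually (lt_mem_nhds (a := 0) (by simpa using ha))
  exact h3.mono fun n hn => hn.le

lemma eventually_incr (p : ℝ) (hp : 0 < p) (hq : 0 < 1 - p) :
    ∀ᶠ n : ℕ in Filter.atTop,
      Real.log (((n : ℝ) + 1) / n) / 2 ≤ binomEnt (n + 1) p - binomEnt n p := by
  by_cases hh : p = 1 / 2
  · filter_upwards [eventually_poly (1 / 6) (-2) (8 / 15) (by norm_num),
      Filter.eventually_ge_atTop 1] with n h1 h2
    have l := lower7 n p hh _ rfl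
    have u := log_upper n h2
    have hx : (0 : ℝ) < 1 / ((n : ℝ) + 1) := by positivity
    generalize 1 / ((n : ℝ) + 1) = x at *
    have := mul_nonneg (pow_pos hx 3).le h1
    nlinarith
  · have ha : 0 < (1 - p * (1 - p)) / (12 * (p * (1 - p))) - 1 / 4 := by
      have : (1 - p * (1 - p)) / (12 * (p * (1 - p))) - 1 / 4
          = (1 - 2 * p) ^ 2 / (12 * (p * (1 - p))) := by
        have := hq.ne'
        field_simp; ring
      rw [this]
      have : 1 - 2 * p ≠ 0 := fun h => hh (by linarith)
      positivity
    have key := fun n => lower5 n p hp hq _ rfl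
    generalize (1 - p * (1 - p)) / (12 * (p * (1 - p))) = A at *
    generalize ((1 - 3 * (p * (1 - p))) * (1 - 6 * (p * (1 - p))) / (12 * (p * (1 - p)) ^ 2)
        - (1 - 2 * p) ^ 2 * (1 - 2 * (p * (1 - p))) * (10 * (p * (1 - p)))
          / (20 * (p * (1 - p)) ^ 3)) = B at *
    generalize ((1 - 2 * p) ^ 2 * (1 - 2 * (p * (1 - p))) * (1 - 12 * (p * (1 - p)))
          / (20 * (p * (1 - p)) ^ 3)) = C at *
    filter_upwards [eventually_poly (A - 1 / 4) (B - 1 / 6) (-C - 1) ha,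
      Filter.eventually_ge_atTop 1] with n h1 h2
    have l := key n
    have u := log_upper n h2
    have hx : (0 : ℝ) < 1 / ((n : ℝ) + 1) := by positivity
    generalize 1 / ((n : ℝ) + 1) = x at *
    have := mul_nonneg (pow_pos hx 2).le h1
    nlinarith

theorem epi_binomial_eventually (p : ℝ) (hp : p ∈ Set.Ioo (0:ℝ) 1) :
    ∃ n₀ : ℕ, ∀ m n : ℕ, n₀ ≤ m → n₀ ≤ n →
      Real.exp (2 * binomEnt (m + n) p) ≥
        Real.exp (2 * binomEnt m p) + Real.exp (2 * binomEnt n p) := by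
  obtain ⟨N, hN⟩ := Filter.eventually_atTop.1
    (eventually_incr p hp.1 (by linarith [hp.2]))
  have mono : ∀ a b : ℕ, N + 1 ≤ a → a ≤ b →
      2 * binomEnt a p - Real.log a ≤ 2 * binomEnt b p - Real.log b := by
    intro a b ha hab
    induction b, hab using Nat.le_induction with
    | base => exact le_rfl
    | succ b hb ih =>
      have h := hN b (by omega)
      have hb0 : (0 : ℝ) < b := by exact_mod_cast (by omega : 0 < b)
      rw [Real.log_div (by positivity) hb0.ne'] at h
      push_cast
      linarith
  have e : ∀ a : ℕ, 0 < a → Real.exp (2 * binomEnt a p)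
      = a * Real.exp (2 * binomEnt a p - Real.log a) := by
    intro a ha
    have ha : (0 : ℝ) < a := by exact_mod_cast ha
    rw [Real.exp_sub, Real.exp_log ha]; field_simp
  refine ⟨N + 1, fun m n hm hn => ?_⟩
  rw [e (m + n) (by omega), e m (by omega), e n (by omega)]
  have h1 := Real.exp_le_exp.2 (mono m (m + n) hm (by omega))
  have h2 := Real.exp_le_exp.2 (mono n (m + n) hn (by omega))
  have h3 := mul_le_mul_of_nonneg_left h1 (Nat.cast_nonneg (α := ℝ) m)
  have h4 := mul_le_mul_of_nonneg_left h2 (Nat.cast_nonneg (α := ℝ) n)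
  have h5 : ((m + n : ℕ) : ℝ) * Real.exp (2 * binomEnt (m + n) p - Real.log ((m + n : ℕ) : ℝ))
    = m * Real.exp (2 * binomEnt (m + n) p - Real.log ((m + n : ℕ) : ℝ))
      + n * Real.exp (2 * binomEnt (m + n) p - Real.log ((m + n : ℕ) : ℝ)) := by
    push_cast; ring
  rw [h5]
  exact add_le_add h3 h4
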